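/- arXiv:1902.04908 — 2 statements merged into one kernel-verified Lean document; each statement's English description precedes it below -/
import Mathlib

section
/- Let G be a finite group with identity e and let S be a subset of G containing e such that |S| divides |G|. Then S is a subgroup of G (i.e., S is closed under multiplication and inverses) if and only if there exist a finite group H with identity e' and a bijection φ : H → S such that φ(e') = e and Θ_G(S) = φ̂(Θ(H)^{|G|/|H|}), i.e., the generalized group determinant of G to S equals the (|G|/|H|)-th power of the group determinant of H after renaming each variable x_h to x_{φ(h)}. -/
/-- The group determinant `Θ(G)` of a finite group `G`, as a multivariate polynomial over a
commutative ring `R` in independent commuting variables `x_g` (`g ∈ G`):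
`Θ(G) = det((x_{g h⁻¹})_{g,h ∈ G})`. -/
noncomputable def groupDet (R G : Type*) [CommRing R] [Group G] [Finite G] :
    MvPolynomial G R := by
  classical
  letI := Fintype.ofFinite G
  exact Matrix.det (Matrix.of fun g h : G => MvPolynomial.X (g * h⁻¹))

/-- The generalized group determinant `Θ_G(S)` of a finite group `G` to a subset `S ⊆ G`,
in variables `x_s` (`s ∈ S`), where `x_g = 0` for `g ∈ G \ S`:
`Θ_G(S) = det((x_{g h⁻¹})_{g,h ∈ G})`. -/
noncomputable def genGroupDet (R G : Type*) [CommRing R] [Group G] [Finite G] (S : Set G) :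
    MvPolynomial S R := by
  classical
  letI := Fintype.ofFinite G
  exact Matrix.det (Matrix.of fun g h : G =>
    if hm : g * h⁻¹ ∈ S then MvPolynomial.X (⟨g * h⁻¹, hm⟩ : S) else 0)

open Classical in
lemma genGroupDet_eq {G : Type*} [Group G] [Fintype G] (S : Set G) :
    genGroupDet ℂ G S = Matrix.det (Matrix.of fun g h : G =>
      if hm : g * h⁻¹ ∈ S then MvPolynomial.X (⟨g * h⁻¹, hm⟩ : S) else 0) := by
  unfold genGroupDet
  congr!

open Classical in
lemma groupDet_eq {H : Type*} [Group H] [Fintype H] :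
    groupDet ℂ H = Matrix.det (Matrix.of fun g h : H => MvPolynomial.X (g * h⁻¹)) := by
  unfold groupDet
  congr!

/-- The matrix `(d (g h⁻¹))`. -/
def gmat {K : Type*} [Group K] (d : K → ℂ) : Matrix K K ℂ := Matrix.of fun g h => d (g * h⁻¹)

open Classical in
/-- Extension by zero. -/
noncomputable def extz {G : Type*} (S : Set G) (v : S → ℂ) (g : G) : ℂ :=
  if h : g ∈ S then v ⟨g, h⟩ else 0

open Classical in
lemma eval_genGroupDet {G : Type*} [Group G] [Fintype G] (S : Set G) (v : S → ℂ) :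
    MvPolynomial.eval v (genGroupDet ℂ G S) = (gmat (extz S v)).det := by
  rw [genGroupDet_eq]
  rw [RingHom.map_det]
  convert rfl using 2
  ext g h
  simp only [gmat, extz, RingHom.mapMatrix_apply, Matrix.map_apply, Matrix.of_apply]
  split_ifs <;> simp

open Classical in
lemma eval_groupDet {H : Type*} [Group H] [Fintype H] (v : H → ℂ) :
    MvPolynomial.eval v (groupDet ℂ H) = (gmat v).det := by
  rw [groupDet_eq]
  rw [RingHom.map_det]
  convert rfl using 2
  ext g h
  simp [gmat]

lemma gmat_add {K : Type*} [Group K] (c d : K → ℂ) : gmat (c + d) = gmat c + gmat d := rfl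

lemma gmat_sub {K : Type*} [Group K] (c d : K → ℂ) : gmat (c - d) = gmat c - gmat d := rfl

lemma gmat_smul {K : Type*} [Group K] (t : ℂ) (d : K → ℂ) : gmat (t • d) = t • gmat d := rfl

open Classical in
lemma gmat_single_one {K : Type*} [Group K] : gmat (Pi.single (1 : K) 1) = 1 := by
  ext g h
  simp [gmat, Matrix.one_apply, Pi.single_apply, mul_inv_eq_one]

open Classical in
lemma gmat_single_mul {K : Type*} [Group K] [Fintype K] (a b : K) :
    gmat (Pi.single a 1) * gmat (Pi.single b 1) = gmat (Pi.single (a * b) 1) := by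
  ext g h
  simp only [gmat, Matrix.mul_apply, Matrix.of_apply, Pi.single_apply]
  rw [Finset.sum_eq_single (b * h)]
  · simp only [mul_inv_cancel_right, if_true, mul_one, mul_inv_rev]
    congr 1
    rw [← mul_assoc, mul_inv_eq_iff_eq_mul]
  · intro x _ hx
    rw [if_neg (c := x * h⁻¹ = b), mul_zero]
    rw [mul_inv_eq_iff_eq_mul]; exact hx
  · simp

open Classical in
lemma trace_gmat_single {K : Type*} [Group K] [Fintype K] (a : K) :
    (gmat (Pi.single a 1)).trace = (Fintype.card K : ℂ) * if a = 1 then 1 else 0 := by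
  simp [gmat, Matrix.trace, Pi.single_apply, eq_comm]

lemma extz_add {G : Type*} (S : Set G) (v w : S → ℂ) : extz S (v + w) = extz S v + extz S w := by
  ext g; simp only [extz, Pi.add_apply]; split_ifs <;> simp

lemma extz_sub {G : Type*} (S : Set G) (v w : S → ℂ) : extz S (v - w) = extz S v - extz S w := by
  ext g; simp only [extz, Pi.sub_apply]; split_ifs <;> simp

lemma extz_smul {G : Type*} (S : Set G) (t : ℂ) (w : S → ℂ) :
    extz S (t • w) = t • extz S w := by
  ext g; simp only [extz, Pi.smul_apply]; split_ifs <;> simp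

open Classical in
lemma extz_single {G : Type*} (S : Set G) (s : S) :
    extz S (Pi.single s 1) = Pi.single (s : G) 1 := by
  ext g
  simp only [extz, Pi.single_apply]
  split_ifs with h1 h2 h3 h3 h3
  · rfl
  · exact absurd (congrArg Subtype.val h2) h3
  · exact absurd (Subtype.ext h3) h2
  · rfl
  · exact absurd (h3 ▸ s.2) h1
  · rfl

lemma cube_factor {K : Type*} [Fintype K] [DecidableEq K] (A : Matrix K K ℂ) (t w w' : ℂ)
    (h1 : w + w' = -1) (h2 : w * w' = 1) :
    (t ^ 3) • (1 : Matrix K K ℂ) - A ^ 3 =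
      (t • 1 - A) * (t • 1 - w • A) * (t • 1 - w' • A) := by
  have e : A ^ 3 = A * A * A := by rw [pow_succ, pow_two]
  simp only [e, sub_mul, mul_sub, smul_mul_assoc, mul_smul_comm, one_mul, mul_one, smul_sub]
  match_scalars
  · ring
  · linear_combination h2
  · linear_combination t ^ 2 * h1
  · linear_combination -t * h1 - t * h2

lemma exists_omega : ∃ w w' : ℂ, w + w' = -1 ∧ w * w' = 1 := by
  obtain ⟨s, hs⟩ := IsAlgClosed.exists_pow_nat_eq (-3 : ℂ) (n := 2) (by norm_num)
  refine ⟨(-1 + s) / 2, (-1 - s) / 2, by ring, ?_⟩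
  linear_combination -hs / 4

lemma trace_cube {K L : Type*} [Fintype K] [DecidableEq K] [Fintype L] [DecidableEq L]
    (A : Matrix K K ℂ) (B : Matrix L L ℂ) (k : ℕ)
    (h : ∀ t u : ℂ, (t • 1 - u • A).det = (t • 1 - u • B).det ^ k) :
    (A ^ 3).trace = k * (B ^ 3).trace := by
  obtain ⟨w, w', h1, h2⟩ := exists_omega
  have key : (A ^ 3).charpoly = (B ^ 3).charpoly ^ k := by
    apply Polynomial.funext
    intro r
    obtain ⟨t, rfl⟩ := IsAlgClosed.exists_pow_nat_eq r (n := 3) (by norm_num)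
    rw [Polynomial.eval_pow, Matrix.eval_charpoly, Matrix.eval_charpoly]
    have e1 := h t 1
    rw [one_smul, one_smul] at e1
    have sA : Matrix.scalar K (t ^ 3) = (t ^ 3) • (1 : Matrix K K ℂ) := by
      rw [Matrix.smul_one_eq_diagonal]; rfl
    have sB : Matrix.scalar L (t ^ 3) = (t ^ 3) • (1 : Matrix L L ℂ) := by
      rw [Matrix.smul_one_eq_diagonal]; rfl
    rw [sA, sB, cube_factor A t w w' h1 h2, cube_factor B t w w' h1 h2]
    simp only [Matrix.det_mul, e1, h, mul_pow]
  rw [Matrix.trace_eq_sum_roots_charpoly, Matrix.trace_eq_sum_roots_charpoly, key,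
    Polynomial.roots_pow, Multiset.sum_nsmul, nsmul_eq_mul]

lemma polar {K : Type*} [Fintype K] [DecidableEq K] (x y z : Matrix K K ℂ) :
    ((x + y + z) ^ 3).trace - ((x + y) ^ 3).trace - ((y + z) ^ 3).trace - ((x + z) ^ 3).trace
      + (x ^ 3).trace + (y ^ 3).trace + (z ^ 3).trace
      = 3 * ((x * y * z).trace + (y * x * z).trace) := by
  have e : (x + y + z) ^ 3 - (x + y) ^ 3 - (y + z) ^ 3 - (x + z) ^ 3 + x ^ 3 + y ^ 3 + z ^ 3
      = x * y * z + y * z * x + z * x * y + (y * x * z + x * z * y + z * y * x) := by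
    noncomm_ring
  have := congrArg Matrix.trace e
  simp only [Matrix.trace_add, Matrix.trace_sub] at this
  rw [this, Matrix.trace_mul_cycle y z x, Matrix.trace_mul_cycle z x y,
    Matrix.trace_mul_cycle y z x, Matrix.trace_mul_cycle x z y, Matrix.trace_mul_cycle z y x]
  have := Matrix.trace_mul_cycle x y z
  have := Matrix.trace_mul_cycle y x z
  have := Matrix.trace_mul_cycle z y x
  have := Matrix.trace_mul_cycle z x y
  have := Matrix.trace_mul_cycle y z x
  grind

open Classical in
lemma count_eq {G : Type*} [Group G] [Fintype G] (S : Set G) (h1S : (1 : G) ∈ S)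
    {H : Type} [Group H] [Fintype H] (φ : H → S) (hφ : Function.Bijective φ)
    (hφ1 : φ 1 = ⟨1, h1S⟩) (k : ℕ) (hk : Fintype.card G = k * Fintype.card H)
    (hdet : genGroupDet ℂ G S = MvPolynomial.rename φ ((groupDet ℂ H) ^ k)) (a b c : H) :
    ((if (φ a * φ b * φ c : G) = 1 then 1 else 0) + (if (φ b * φ a * φ c : G) = 1 then 1 else 0) : ℂ)
     = (if a * b * c = 1 then 1 else 0) + (if b * a * c = 1 then 1 else 0) := by
  have hd : ∀ v : S → ℂ, (gmat (extz S v)).det = (gmat (v ∘ φ)).det ^ k := by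
    intro v
    rw [← eval_genGroupDet, hdet, MvPolynomial.eval_rename, map_pow, eval_groupDet]
  have hs : ∀ x : H, (Pi.single (φ x) 1 : S → ℂ) ∘ φ = Pi.single x 1 := by
    intro x
    ext y
    simp [Pi.single_apply, hφ.1.eq_iff]
  have ht : ∀ v : S → ℂ, (gmat (extz S v) ^ 3).trace = k * (gmat (v ∘ φ) ^ 3).trace := by
    intro v
    apply trace_cube
    intro t u
    have := hd (t • Pi.single (φ 1) 1 - u • v)
    rw [extz_sub, extz_smul, extz_smul, extz_single, gmat_sub, gmat_smul, gmat_smul, hφ1,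
      gmat_single_one, ← hφ1] at this
    rw [this, ← gmat_single_one, ← hs 1]
    rfl
  let x : S → ℂ := Pi.single (φ a) 1
  let y : S → ℂ := Pi.single (φ b) 1
  let z : S → ℂ := Pi.single (φ c) 1
  have pG := polar (gmat (extz S x)) (gmat (extz S y)) (gmat (extz S z))
  have pH := polar (gmat (x ∘ φ)) (gmat (y ∘ φ)) (gmat (z ∘ φ))
  simp only [← gmat_add, ← extz_add, ht] at pG
  have e : ∀ v w : S → ℂ, (v + w) ∘ φ = v ∘ φ + w ∘ φ := fun _ _ => rfl
  simp only [e, gmat_add] at pG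
  simp only [x, y, z, hs, extz_single, gmat_single_mul, trace_gmat_single] at pG pH
  have hn : (Fintype.card G : ℂ) = k * Fintype.card H := by exact_mod_cast hk
  have hn0 : (Fintype.card G : ℂ) ≠ 0 := by exact_mod_cast Fintype.card_ne_zero
  have : (Fintype.card G : ℂ) * ((if (φ a * φ b * φ c : G) = 1 then 1 else 0) +
      (if (φ b * φ a * φ c : G) = 1 then 1 else 0)) = (Fintype.card G : ℂ) *
      ((if a * b * c = 1 then 1 else 0) + (if b * a * c = 1 then 1 else 0)) := by
    linear_combination (k * pH - pG) / 3 + ((if a * b * c = 1 then 1 else 0) +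
      (if b * a * c = 1 then 1 else 0)) * (-hn)
  exact mul_left_cancel₀ hn0 this

lemma backward {G : Type*} [Group G] [Fintype G] (S : Set G) (h1S : (1 : G) ∈ S)
    {H : Type} [Group H] [Fintype H] (φ : H → S) (hφ : Function.Bijective φ)
    (hφ1 : φ 1 = ⟨1, h1S⟩) (k : ℕ) (hk : Fintype.card G = k * Fintype.card H)
    (hdet : genGroupDet ℂ G S = MvPolynomial.rename φ ((groupDet ℂ H) ^ k)) :
    (∀ a ∈ S, ∀ b ∈ S, a * b ∈ S) ∧ ∀ a ∈ S, a⁻¹ ∈ S := by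
  classical
  have C := count_eq S h1S φ hφ hφ1 k hk hdet
  have h1 : ((φ 1 : S) : G) = 1 := by rw [hφ1]
  have inv : ∀ a ∈ S, a⁻¹ ∈ S := by
    intro a ha
    obtain ⟨x, hx⟩ := hφ.2 ⟨a, ha⟩
    have hxa : (φ x : G) = a := by rw [hx]
    have := C x x⁻¹ 1
    rw [h1, hxa] at this
    simp only [mul_one, mul_inv_cancel, inv_mul_cancel, if_true] at this
    have h3 : a * φ x⁻¹ = 1 := by
      by_contra hne
      rw [if_neg hne] at this
      split_ifs at this <;> norm_num at this
    rw [inv_eq_of_mul_eq_one_right h3]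
    exact (φ x⁻¹).2
  refine ⟨?_, inv⟩
  intro a ha b hb
  obtain ⟨x, hx⟩ := hφ.2 ⟨a, ha⟩
  obtain ⟨y, hy⟩ := hφ.2 ⟨b, hb⟩
  have hxa : (φ x : G) = a := by rw [hx]
  have hyb : (φ y : G) = b := by rw [hy]
  -- it suffices to find a third element
  have suff : ∀ z, a * b * φ z = 1 → a * b ∈ S := by
    intro z hz
    rw [eq_inv_of_mul_eq_one_left hz]
    exact inv _ (φ z).2
  by_contra hab
  have n1 : ∀ z, a * b * φ z ≠ 1 := fun z hz => hab (suff z hz)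
  have C1 := C x y (x * y)⁻¹
  have C2 := C x y (y * x)⁻¹
  rw [hxa, hyb, if_neg (n1 _)] at C1 C2
  simp only [mul_inv_cancel, if_true] at C1 C2
  by_cases hc : x * y = y * x
  · rw [hc] at C1
    simp only [mul_inv_cancel, if_true] at C1
    split_ifs at C1 <;> norm_num at C1
  · have i1 : y * x * (x * y)⁻¹ ≠ 1 := fun h => hc (mul_inv_eq_one.1 h).symm
    have i2 : x * y * (y * x)⁻¹ ≠ 1 := fun h => hc (mul_inv_eq_one.1 h)
    rw [if_neg i1] at C1
    rw [if_neg i2] at C2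
    have j1 : b * a * φ (x * y)⁻¹ = 1 := by
      by_contra hne
      rw [if_neg hne] at C1; norm_num at C1
    have j2 : b * a * φ (y * x)⁻¹ = 1 := by
      by_contra hne
      rw [if_neg hne] at C2; norm_num at C2
    have := mul_left_cancel (j1.trans j2.symm)
    exact hc (inv_injective (hφ.1 (Subtype.ext this)))

lemma forward {G : Type*} [Group G] [Fintype G] (K : Subgroup G)
    {H : Type} [Group H] [Fintype H] (φ : H ≃* K) :
    genGroupDet ℂ G (K : Set G) = MvPolynomial.rename (fun h => (φ h : (K : Set G)))
      ((groupDet ℂ H) ^ (Fintype.card G / Fintype.card H)) := by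
  classical
  let f : H × (G ⧸ K) → G := fun p => φ p.1 * p.2.out⁻¹
  have hf : Function.Bijective f := by
    constructor
    · rintro ⟨h, q⟩ ⟨h', q'⟩ hh
      simp only [f] at hh
      have hq : q = q' := by
        rw [← QuotientGroup.out_eq' q, ← QuotientGroup.out_eq' q', QuotientGroup.eq]
        have : q.out⁻¹ * q'.out = ((φ h)⁻¹ * φ h' : K) := by
          push_cast
          rw [eq_inv_mul_iff_mul_eq, ← mul_assoc, hh]; group
        rw [this]; exact SetLike.coe_mem _
      subst hq
      have := mul_right_cancel hh
      rw [φ.injective (Subtype.ext this)]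
    · intro g
      obtain ⟨k, hk⟩ := QuotientGroup.mk_out_eq_mul K g⁻¹
      refine ⟨(φ.symm k, QuotientGroup.mk g⁻¹), ?_⟩
      simp [f, hk]
  have hcard : Fintype.card G / Fintype.card H = Fintype.card (G ⧸ K) := by
    rw [← Fintype.card_of_bijective hf, Fintype.card_prod,
      Nat.mul_div_cancel_left _ Fintype.card_pos]
  rw [hcard, map_pow]
  rw [genGroupDet_eq, groupDet_eq]
  rw [AlgHom.map_det]
  let M : Matrix H H (MvPolynomial (K : Set G) ℂ) :=
    Matrix.of fun g h => MvPolynomial.X (φ (g * h⁻¹) : (K : Set G))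
  have hM : M.det ^ Fintype.card (G ⧸ K) =
      (Matrix.blockDiagonal (fun _ : G ⧸ K => M)).det := by
    rw [Matrix.det_blockDiagonal]; simp
  trans M.det ^ Fintype.card (G ⧸ K)
  · rw [hM]
    rw [← Matrix.det_submatrix_equiv_self (Equiv.ofBijective f hf)]
    convert rfl using 2
    ext1 ⟨h, q⟩ ⟨h', q'⟩
    simp only [Matrix.blockDiagonal_apply, Matrix.submatrix_apply, Matrix.of_apply,
      Equiv.ofBijective_apply, f, M]
    by_cases hq : q = q'
    · subst hq
      have e : (φ h : G) * q.out⁻¹ * (φ h' * q.out⁻¹)⁻¹ = φ (h * h'⁻¹) := by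
        simp
      rw [if_pos rfl]
      simp only [e]
      have hmem : (φ (h * h'⁻¹) : G) ∈ (K : Set G) := (φ (h * h'⁻¹)).2
      rw [dif_pos hmem]
      rfl
    · rw [if_neg hq, dif_neg]
      intro hm
      apply hq
      rw [← QuotientGroup.out_eq' q, ← QuotientGroup.out_eq' q', QuotientGroup.eq]
      have : q.out⁻¹ * q'.out =
          (φ h : G)⁻¹ * ((φ h : G) * q.out⁻¹ * (φ h' * q'.out⁻¹)⁻¹) * φ h' := by group
      rw [this]
      exact K.mul_mem (K.mul_mem (K.inv_mem (φ h).2) hm) (φ h').2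
  · congr 1
    convert rfl using 2
    ext1 g h
    simp [M]

/-- A subset `S` of a finite group `G` with `e ∈ S` and `|S| ∣ |G|` is a subgroup iff there is a
finite group `H` and a bijection `φ : H → S` with `φ(e') = e` and
`Θ_G(S) = φ̂(Θ(H)^{|G|/|H|})`. -/
theorem subset_isSubgroup_iff_genGroupDet_eq_pow {G : Type*} [Group G] [Fintype G]
    (S : Set G) (h1S : (1 : G) ∈ S) (hdvd : Nat.card S ∣ Fintype.card G) :
    ((∀ a ∈ S, ∀ b ∈ S, a * b ∈ S) ∧ ∀ a ∈ S, a⁻¹ ∈ S) ↔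
      ∃ (H : Type) (_ : Group H) (_ : Fintype H) (φ : H → S),
        Function.Bijective φ ∧ φ 1 = ⟨1, h1S⟩ ∧
        genGroupDet ℂ G S =
          MvPolynomial.rename φ ((groupDet ℂ H) ^ (Fintype.card G / Fintype.card H)) := by
  constructor
  · rintro ⟨hm, hi⟩
    let K : Subgroup G :=
      { carrier := S, mul_mem' := fun {a b} ha hb => hm a ha b hb, one_mem' := h1S,
        inv_mem' := fun {a} ha => hi a ha }
    let e : Shrink.{0} K ≃* K := Shrink.mulEquiv
    let _ : Fintype (Shrink.{0} K) := Fintype.ofFinite _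
    refine ⟨Shrink.{0} K, inferInstance, inferInstance, fun h => e h, e.bijective, ?_, ?_⟩
    · exact e.map_one
    · exact forward K e
  · rintro ⟨H, _, _, φ, hφ, hφ1, hdet⟩
    refine backward S h1S φ hφ hφ1 _ ?_ hdet
    have : Nat.card S = Fintype.card H := by
      rw [← Nat.card_eq_of_bijective φ hφ, Nat.card_eq_fintype_card]
    rw [this] at hdvd
    exact (Nat.div_mul_cancel hdvd).symm
end

section
/- Let G and H be finite groups with identity elements e and e' respectively, let K be a field whose characteristic does not divide |G|, and let φ : G → H be a bijection with φ(e) = e'. Suppose that applying the induced variable renaming φ̂ (sending x_g to x_{φ(g)}) to the group determinant of G over K yields the group determinant of H: φ̂(Θ(G)) = Θ(H). Then φ is either a group isomorphism or a group anti-isomorphism (i.e., either φ(g g') = φ(g) φ(g') for all g, g' ∈ G, or φ(g g') = φ(g') φ(g) for all g, g' ∈ G); in particular G is isomorphic to H. -/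
namespace FS

open Matrix

/-- Group matrix attached to a function. -/
def M {G S : Type*} [Group G] [CommRing S] (x : G → S) : Matrix G G S :=
  Matrix.of fun a b => x (a * b⁻¹)

section basic
variable {G S : Type*} [Group G] [CommRing S]

lemma M_add (x y : G → S) : M (x + y) = M x + M y := rfl
lemma M_sub (x y : G → S) : M (x - y) = M x - M y := rfl
lemma M_smul (s : S) (y : G → S) : M (s • y) = s • M y := rfl

variable [Fintype G] [DecidableEq G]

lemma M_one : M (Pi.single (1 : G) (1 : S)) = 1 := by
  ext a b
  simp [M, Matrix.one_apply, Pi.single_apply, mul_inv_eq_one]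

lemma mul_P (x : G → S) (k : G) (a b : G) :
    ((M x * M (Pi.single k 1) : Matrix G G S)) a b = x (a * b⁻¹ * k⁻¹) := by
  rw [Matrix.mul_apply, Finset.sum_eq_single (k * b)]
  · simp [M, mul_assoc]
  · intro c _ hc
    have : c * b⁻¹ ≠ k := fun h => hc (by rw [← h]; simp)
    simp [M, this]
  · simp

lemma P_mul (g h : G) : M (Pi.single g (1 : S)) * M (Pi.single h 1) = M (Pi.single (g * h) 1) := by
  ext a b
  rw [mul_P]
  simp only [M, Matrix.of_apply, Pi.single_apply, mul_inv_eq_iff_eq_mul]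

lemma trace_mul_P (x : G → S) (k : G) :
    Matrix.trace (M x * M (Pi.single k 1)) = (Fintype.card G : S) * x k⁻¹ := by
  simp [Matrix.trace, mul_P]

lemma det_dual {n : Type*} [Fintype n] [DecidableEq n] (A A' B : Matrix n n S) (h : A * A' = 1) :
    (A.map (algebraMap S (DualNumber S)) +
      (DualNumber.eps : DualNumber S) • B.map (algebraMap S (DualNumber S))).det
      = TrivSqZeroExt.inl A.det + TrivSqZeroExt.inr (A.det * (A' * B).trace) := by
  have e : A.map (algebraMap S (DualNumber S)) +
      (DualNumber.eps : DualNumber S) • B.map (algebraMap S (DualNumber S)) =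
      A.map (algebraMap S (DualNumber S)) *
        (1 + (DualNumber.eps : DualNumber S) • (A' * B).map (algebraMap S (DualNumber S))) := by
    rw [Matrix.mul_add, Matrix.mul_one, Matrix.mul_smul, ← Matrix.map_mul, ← Matrix.mul_assoc, h,
      Matrix.one_mul]
  rw [e, Matrix.det_mul, Matrix.det_one_add_smul]
  have e2 : (DualNumber.eps : DualNumber S) ^ 2 = 0 := by rw [pow_two, DualNumber.eps_mul_eps]
  rw [e2, mul_zero, add_zero]
  have e3 : (A.map (algebraMap S (DualNumber S))).det = algebraMap S (DualNumber S) A.det := by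
    rw [RingHom.map_det]; rfl
  have e4 : ((A' * B).map (algebraMap S (DualNumber S))).trace
      = algebraMap S (DualNumber S) (A' * B).trace := by
    simp only [Matrix.trace, Matrix.diag, Matrix.map_apply, map_sum]
  rw [e3, e4]
  apply TrivSqZeroExt.ext <;> simp [TrivSqZeroExt.algebraMap_eq_inl']

end basic

lemma T0 {G H : Type*} [Group G] [Fintype G] [DecidableEq G] [Group H] [Fintype H] [DecidableEq H]
    {S : Type*} [CommRing S] (φ : G → H) (hφ : Function.Bijective φ)
    (hn : IsUnit (Fintype.card G : S))
    (hd : ∀ y : H → DualNumber S, (M (y ∘ φ)).det = (M y).det)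
    (x x' : G → S) (y y' : H → S) (hxy : ∀ g, y (φ g) = x g)
    (hx : M x * M x' = 1) (hy : M y * M y' = 1) (k : G) : x' k⁻¹ = y' (φ k)⁻¹ := by
  have h := hd (fun b => algebraMap S (DualNumber S) (y b) +
    DualNumber.eps * algebraMap S (DualNumber S) ((Pi.single (φ k) 1 : H → S) b))
  have e1 : M ((fun b => algebraMap S (DualNumber S) (y b) +
    DualNumber.eps * algebraMap S (DualNumber S) ((Pi.single (φ k) 1 : H → S) b)) ∘ φ)
    = (M x).map (algebraMap S (DualNumber S)) +
      (DualNumber.eps : DualNumber S) • (M (Pi.single k 1)).map (algebraMap S (DualNumber S)) := by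
    refine Matrix.ext fun a b => ?_
    simp only [M, Matrix.of_apply, Matrix.add_apply, Matrix.smul_apply, Matrix.map_apply,
      Function.comp, hxy, smul_eq_mul, Pi.single_apply, hφ.1.eq_iff]
  have e2 : M ((fun b => algebraMap S (DualNumber S) (y b) +
    DualNumber.eps * algebraMap S (DualNumber S) ((Pi.single (φ k) 1 : H → S) b)))
    = (M y).map (algebraMap S (DualNumber S)) +
      (DualNumber.eps : DualNumber S) • (M (Pi.single (φ k) 1)).map (algebraMap S (DualNumber S)) := rfl
  rw [e1, e2, det_dual _ _ _ hx, det_dual _ _ _ hy, trace_mul_P, trace_mul_P] at h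
  have hf := congrArg TrivSqZeroExt.fst h
  have hs := congrArg TrivSqZeroExt.snd h
  simp at hf hs
  have u : IsUnit (M x).det := by
    apply IsUnit.of_mul_eq_one (M x').det
    rw [← Matrix.det_mul, hx, Matrix.det_one]
  rw [← hf, Fintype.card_of_bijective hφ] at hs
  rw [Fintype.card_of_bijective hφ] at hn
  exact hn.mul_left_cancel (u.mul_left_cancel hs)

lemma ring1 {S A : Type*} [CommRing S] [Ring A] [Algebra S A] (s t : S) (hs : s * s = 0)
    (ht : t * t = 0) (a b : A) :
    (1 - s • a - t • b) * (1 + s • a + t • b + (s * t) • (a * b + b * a)) = 1 := by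
  have h1 : s * t * s = 0 := by rw [mul_right_comm, hs, zero_mul]
  have h2 : s * t * t = 0 := by rw [mul_assoc, ht, mul_zero]
  have h1' : s * (s * t) = 0 := by rw [← mul_assoc, hs, zero_mul]
  have h2' : t * (s * t) = 0 := by rw [mul_left_comm, ht, mul_zero]
  simp only [mul_add, sub_mul, one_mul, mul_one, smul_mul_assoc, mul_smul_comm, smul_smul,
    smul_add, smul_sub, hs, ht, h1, h2, h1', h2', zero_smul, mul_comm t s]
  abel

lemma ring2 {S A : Type*} [CommRing S] [Ring A] [Algebra S A] (s : S) (hs : s * s = 0)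
    (a b c : A) (h : a * c = 1) :
    (a + s • b) * (c - s • (c * b * c)) = 1 := by
  have : a * (c * b * c) = b * c := by rw [← mul_assoc, ← mul_assoc, h, one_mul]
  simp only [mul_sub, add_mul, smul_mul_assoc, mul_smul_comm, smul_add, smul_smul, hs, zero_smul,
    h, this]
  abel

lemma exists_S (K : Type*) [Field K] : ∃ (s t : DualNumber (DualNumber K)),
    s * s = 0 ∧ t * t = 0 ∧ ∀ z : K, algebraMap K _ z * (s * t) = 0 → z = 0 := by
  refine ⟨TrivSqZeroExt.inl DualNumber.eps, DualNumber.eps, ?_, DualNumber.eps_mul_eps, ?_⟩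
  · rw [← TrivSqZeroExt.inl_mul, DualNumber.eps_mul_eps]; rfl
  · intro z h
    have h := congrArg (fun w => TrivSqZeroExt.snd (TrivSqZeroExt.snd w)) h
    simpa [TrivSqZeroExt.algebraMap_eq_inl'] using h

lemma exists_S'.{u} (K : Type u) [Field K] : ∃ (S : Type u) (_ : CommRing S) (_ : Algebra K S)
    (s t : S), s * s = 0 ∧ t * t = 0 ∧ ∀ z : K, algebraMap K S z * (s * t) = 0 → z = 0 :=
  ⟨DualNumber (DualNumber K), inferInstance, inferInstance, exists_S K⟩

section half
variable {G H : Type*} [Group G] [Group H]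

lemma half_key (φ : G → H) (hinj : Function.Injective φ)
    (hinv : ∀ g, φ g⁻¹ = (φ g)⁻¹)
    (hc : ∀ g h, g * h = h * g → φ g * φ h = φ h * φ g)
    (hh : ∀ g h, φ (g * h) = φ g * φ h ∨ φ (g * h) = φ h * φ g)
    (a b c : G) (h1 : φ (a * b) = φ a * φ b) (h2 : φ a * φ b ≠ φ b * φ a)
    (h3 : φ (a * c) = φ c * φ a) (h4 : φ a * φ c ≠ φ c * φ a) : False := by
  have h5 : φ (b * a) = φ b * φ a := by
    rcases hh b a with h | h
    · exact h
    · exact absurd (hc _ _ (hinj (h1.trans h.symm))) h2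
  have h6 : φ (c * a) = φ a * φ c := by
    rcases hh c a with h | h
    · exact absurd (hc _ _ (hinj (h3.trans h.symm))) h4
    · exact h
  have cc : ∀ g h, φ g * φ h = φ h * φ g → g * h = h * g := by
    intro g h e
    apply hinj
    rcases hh g h with u | u <;> rcases hh h g with v | v <;> rw [u, v] <;> simp only [e]
  have p1 := hh (b * a) c
  have p2 := hh b (a * c)
  have q1 := hh c (a * b)
  have q2 := hh (c * a) b
  have r1 := hh b⁻¹ c
  have r2 := hh (a * b)⁻¹ (a * c)
  have er : (a * b)⁻¹ * (a * c) = b⁻¹ * c := by group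
  rw [er] at r2
  rw [mul_assoc] at p1 q2
  rw [hinv] at r1 r2
  rw [h5] at p1
  rw [h3] at p2 r2
  rw [h1] at q1 r2
  rw [h6] at q2
  generalize hA : φ a = A at *
  generalize hB : φ b = B at *
  generalize hC : φ c = C at *
  have hBAC : B * A * C = C * A * B := by
    by_cases hBC : B * C = C * B
    · have s1 := hh (a * b) c
      have s2 := hh a (b * c)
      have s3 := hh (a * c) b
      have s4 : φ (b * c) = B * C := by
        rcases hh b c with h | h <;> simp_all
      have e : b * c = c * b := cc b c (by rw [hB, hC, hBC])
      rw [mul_assoc] at s1 s3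
      rw [← e] at s3
      rw [h1, hC] at s1
      rw [s4, hA] at s2
      rw [h3, hB] at s3
      have t1 : φ (a * (b * c)) = A * B * C := by
        rcases s1 with h | h
        · exact h
        · rcases s2 with h' | h'
          · rw [h', mul_assoc]
          · exfalso; apply h2
            rw [h, hBC, mul_assoc] at h'
            exact mul_left_cancel h'
      have t2 : A * B * C = B * C * A := by
        rcases s3 with h | h
        · exfalso; apply h4
          rw [t1, mul_assoc, hBC, ← mul_assoc] at h
          exact mul_right_cancel h
        · rw [← t1, h, mul_assoc]
      rcases p1 with h | h
      · rcases p2 with h' | h'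
        · exfalso; apply h4
          rw [h, mul_assoc] at h'
          exact mul_left_cancel h'
        · rw [← h, h']
      · exfalso
        have e1 : φ (b * (a * c)) = φ (a * (b * c)) := by
          rw [h, t1, t2, hBC, mul_assoc]
        have e2 := hinj e1
        rw [← mul_assoc, ← mul_assoc] at e2
        have e3 := hc _ _ (mul_right_cancel e2)
        rw [hA, hB] at e3
        exact h2 e3.symm
    · rcases p1 with h | h
      · rcases p2 with h' | h'
        · exfalso; apply h4
          rw [h, mul_assoc] at h'
          exact mul_left_cancel h'
        · rw [← h, h']
      · rcases p2 with h' | h'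
        · exfalso; apply hBC
          rw [h, ← mul_assoc, ← mul_assoc] at h'
          exact (mul_right_cancel h').symm
        · exfalso; apply h2
          rw [h, mul_assoc] at h'
          exact (mul_left_cancel h').symm
  by_cases hBC : B * C = C * B
  · -- here `b⁻¹ c` is sent to `B⁻¹ C`, which commutes with `A * B`
    have v : φ (b⁻¹ * c) = B⁻¹ * C := by
      have : C * B⁻¹ = B⁻¹ * C := by
        rw [mul_inv_eq_iff_eq_mul, mul_assoc, ← hBC, inv_mul_cancel_left]
      rcases r1 with h | h
      · exact h
      · rw [h, this]
    have w := hh (a * b) (b⁻¹ * c)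
    have ew : a * b * (b⁻¹ * c) = a * c := by group
    rw [ew, h3, h1, v] at w
    rcases w with h | h
    · apply h4; rw [h]; group
    · -- C A = B⁻¹ C A B
      have : B⁻¹ * C * (A * B) = A * C := by
        have : B⁻¹ * C * (A * B) = B⁻¹ * (C * A * B) := by group
        rw [this, ← hBAC]; group
      rw [this] at h
      exact h4 h.symm
  · rcases r1 with h | h <;> rcases r2 with h' | h' <;> rw [h] at h'
    · apply h4
      have : A * (B * (B⁻¹ * C)) = A * (B * ((A * B)⁻¹ * (C * A))) := by rw [h']
      simp only [_root_.mul_inv_rev] at h'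
      rw [mul_assoc] at h'
      have h'' := mul_left_cancel h'
      rw [eq_inv_mul_iff_mul_eq] at h''
      exact h''
    · apply h4
      have : B * C * A = C * A * B := by
        have h'' : B * (B⁻¹ * C) * A * B = B * (C * A * (A * B)⁻¹) * A * B := by rw [h']
        simp only [_root_.mul_inv_rev, mul_inv_cancel_left, mul_assoc] at h''
        simp only [inv_mul_cancel_left, mul_assoc, inv_mul_cancel, mul_one] at h''
        rw [mul_assoc, mul_assoc, h'']
      rw [← hBAC, mul_assoc, mul_assoc] at this
      exact (mul_left_cancel this).symm
    · apply h2
      have h'' : A * B * (C * B⁻¹) * B = A * B * ((A * B)⁻¹ * (C * A)) * B := by rw [h']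
      rw [mul_inv_cancel_left] at h''
      have : A * B * C = C * A * B := by
        rw [← h'']; group
      rw [← hBAC] at this
      exact mul_right_cancel this
    · apply h2
      rw [mul_assoc] at h'
      have h'' := mul_left_cancel h'
      rw [_root_.mul_inv_rev, ← mul_assoc, eq_mul_inv_iff_mul_eq, inv_mul_eq_iff_eq_mul] at h''
      have h3 : B * (B⁻¹ * A) = B * (A * B⁻¹) := by rw [← h'']; group
      have h4 : B * (B⁻¹ * A) * B = B * (A * B⁻¹) * B := by rw [h3]
      simpa [mul_assoc] using h4

lemma half (φ : G → H) (hinj : Function.Injective φ)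
    (hinv : ∀ g, φ g⁻¹ = (φ g)⁻¹)
    (hc : ∀ g h, g * h = h * g → φ g * φ h = φ h * φ g)
    (hh : ∀ g h, φ (g * h) = φ g * φ h ∨ φ (g * h) = φ h * φ g) :
    (∀ g g', φ (g * g') = φ g * φ g') ∨ (∀ g g', φ (g * g') = φ g' * φ g) := by
  have key : ∀ a, (∀ b, φ (a * b) = φ a * φ b) ∨ (∀ b, φ (a * b) = φ b * φ a) := by
    intro a
    by_contra! hcon
    obtain ⟨⟨c, hc'⟩, ⟨b, hb⟩⟩ := hcon
    have h3 := (hh a c).resolve_left hc'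
    have h1 := (hh a b).resolve_right hb
    exact half_key φ hinj hinv hc hh a b c h1 (fun e => hb (h1.trans e)) h3
      (fun e => hc' (h3.trans e.symm))
  by_contra! hcon
  obtain ⟨⟨p, p', hp⟩, ⟨q, q', hq⟩⟩ := hcon
  have kp := (key p).resolve_left (fun h => hp (h p'))
  have kq := (key q).resolve_right (fun h => hq (h q'))
  rcases key (p * q) with h | h
  · -- p = (p q) q⁻¹
    apply hp
    have hq' : ∀ b, φ (q⁻¹ * b) = φ q⁻¹ * φ b := by
      intro b
      have := kq (q⁻¹ * b)
      rw [mul_inv_cancel_left] at this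
      rw [this, hinv, inv_mul_cancel_left]
    have hall : ∀ b, φ (p * b) = φ (p * q) * φ q⁻¹ * φ b := by
      intro b
      have := h (q⁻¹ * b)
      rw [mul_assoc, mul_inv_cancel_left, hq', ← mul_assoc] at this
      exact this
    have e := h q⁻¹
    rw [mul_inv_cancel_right] at e
    rw [hall, ← e]
  · apply hq
    have hp' : ∀ b, φ (p⁻¹ * b) = φ b * φ p⁻¹ := by
      intro b
      have := kp (p⁻¹ * b)
      rw [mul_inv_cancel_left] at this
      rw [this, hinv, mul_inv_cancel_right]
    have e : ∀ b, φ (q * b) = φ b * φ (p * q) * φ p⁻¹ := by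
      intro b
      have := hp' (p * q * b)
      rw [mul_assoc, inv_mul_cancel_left, ← mul_assoc, h] at this
      exact this
    have e1 : φ q = φ (p * q) * φ p⁻¹ := by
      have := hp' (p * q)
      rwa [inv_mul_cancel_left] at this
    rw [e, e1, mul_assoc]

end half

lemma aeval_groupDet {G K R : Type*} [Group G] [Fintype G] [DecidableEq G] [CommRing K] [CommRing R]
    [Algebra K R] (y : G → R) : MvPolynomial.aeval y (groupDet K G) = (M y).det := by
  have e : groupDet K G = Matrix.det (Matrix.of fun g h : G => MvPolynomial.X (g * h⁻¹)) := by
    unfold groupDet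
    congr!
  rw [e, AlgHom.map_det]
  congr 1
  refine Matrix.ext fun a b => ?_
  simp [M]

end FS

/-- Formanek–Sibley: if `G`, `H` are finite groups, `K` a field with characteristic not dividing
`|G|`, and `φ : G → H` a bijection with `φ(e) = e'` such that `φ̂(Θ(G)) = Θ(H)` over `K`, then
`φ` is a group isomorphism or a group anti-isomorphism; in particular `G ≃* H`. -/
theorem iso_or_antiIso_of_groupDet_eq {G H : Type*} [Group G] [Fintype G] [Group H] [Fintype H]
    (K : Type*) [Field K] (hchar : ¬ (ringChar K ∣ Fintype.card G))
    (φ : G → H) (hφ : Function.Bijective φ) (h1 : φ 1 = 1)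
    (hdet : MvPolynomial.rename φ (groupDet K G) = groupDet K H) :
    ((∀ g g' : G, φ (g * g') = φ g * φ g') ∨ (∀ g g' : G, φ (g * g') = φ g' * φ g)) ∧
      Nonempty (G ≃* H) := by
  classical
  have hcard : (Fintype.card G : K) ≠ 0 := fun h => hchar ((ringChar.spec K _).1 h)
  obtain ⟨S, _, _, s, t, hs, ht, hst⟩ := FS.exists_S' K
  have hu : IsUnit (Fintype.card G : S) := by
    have := (IsUnit.mk0 _ hcard).map (algebraMap K S)
    simpa using this
  have hd : ∀ y : H → DualNumber S,
      (FS.M (y ∘ φ)).det = (FS.M y).det := by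
    intro y
    rw [← FS.aeval_groupDet (K := K), ← FS.aeval_groupDet (K := K), ← hdet,
      MvPolynomial.aeval_rename]
  have T := FS.T0 φ hφ hu hd
  -- inverses
  have hinv : ∀ g, φ g⁻¹ = (φ g)⁻¹ := by
    intro g
    have h := T (Pi.single 1 1 - s • Pi.single g 1 - t • 0) (Pi.single 1 1 + s • Pi.single g 1)
      (Pi.single 1 1 - s • Pi.single (φ g) 1 - t • 0) (Pi.single 1 1 + s • Pi.single (φ g) 1)
      ?_ ?_ ?_ g⁻¹
    · simp only [Pi.add_apply, Pi.smul_apply, smul_eq_mul, inv_inv, Pi.single_eq_same, mul_one] at h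
      by_contra hne
      have h2 : (φ g⁻¹)⁻¹ ≠ φ g := fun e => hne (by rw [← e, inv_inv])
      have h3 : (φ g⁻¹)⁻¹ = 1 ↔ g = 1 := by
        rw [inv_eq_one, ← h1, hφ.1.eq_iff, inv_eq_one]
      simp only [Pi.single_apply, h3, h2, if_false, mul_zero] at h
      have h4 : s = 0 := by simpa using h
      have := hst 1 (by simp [h4])
      exact one_ne_zero this
    · intro k
      simp [Pi.single_apply, hφ.1.eq_iff, ← h1]
    · have := FS.ring1 s (0 : S) hs (by simp) (FS.M (S := S) (Pi.single g 1)) (0 : Matrix G G S)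
      simpa [FS.M_sub, FS.M_add, FS.M_smul, FS.M_one] using this
    · have := FS.ring1 s (0 : S) hs (by simp) (FS.M (S := S) (Pi.single (φ g) 1)) (0 : Matrix H H S)
      simpa [FS.M_sub, FS.M_add, FS.M_smul, FS.M_one] using this
  have hone : ∀ k, φ k = 1 ↔ k = 1 := fun k => by rw [← h1, hφ.1.eq_iff]
  have T' : ∀ (x x' : G → S) (y y' : H → S),
      (∀ g, y (φ g) = x g) → FS.M x * FS.M x' = 1 → FS.M y * FS.M y' = 1 →
      ∀ k, x' k = y' (φ k) := by
    intro x x' y y' a b c k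
    have := T x x' y y' a b c k⁻¹
    rwa [hinv, inv_inv, inv_inv] at this
  -- Jordan identity
  have hJ : ∀ g h k : G, (if k = g * h then (1 : K) else 0) + (if k = h * g then 1 else 0) =
      (if φ k = φ g * φ h then 1 else 0) + (if φ k = φ h * φ g then 1 else 0) := by
    intro g h k
    have e := T' (Pi.single 1 1 - s • Pi.single g 1 - t • Pi.single h 1)
      (Pi.single 1 1 + s • Pi.single g 1 + t • Pi.single h 1 +
        (s * t) • (Pi.single (g * h) 1 + Pi.single (h * g) 1))
      (Pi.single 1 1 - s • Pi.single (φ g) 1 - t • Pi.single (φ h) 1)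
      (Pi.single 1 1 + s • Pi.single (φ g) 1 + t • Pi.single (φ h) 1 +
        (s * t) • (Pi.single (φ g * φ h) 1 + Pi.single (φ h * φ g) 1))
      ?_ ?_ ?_ k
    · simp only [Pi.add_apply, Pi.smul_apply, smul_eq_mul, Pi.single_apply, hφ.1.eq_iff, hone,
        add_right_inj] at e
      rw [← sub_eq_zero]
      apply hst
      rw [← sub_eq_zero, ← mul_sub] at e
      rw [mul_comm, ← e]
      simp only [map_sub, map_add, apply_ite (algebraMap K S), map_one,
        map_zero]
    · intro k
      simp [Pi.single_apply, hφ.1.eq_iff, hone]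
    · have := FS.ring1 s t hs ht (FS.M (S := S) (Pi.single g 1)) (FS.M (S := S) (Pi.single h 1))
      rw [FS.P_mul, FS.P_mul] at this
      simpa only [FS.M_sub, FS.M_add, FS.M_smul, FS.M_one] using this
    · have := FS.ring1 s t hs ht (FS.M (S := S) (Pi.single (φ g) 1)) (FS.M (S := S) (Pi.single (φ h) 1))
      rw [FS.P_mul, FS.P_mul] at this
      simpa only [FS.M_sub, FS.M_add, FS.M_smul, FS.M_one] using this
  -- quadratic identity
  have hQ : ∀ g h : G, φ (g * h * g) = φ g * φ h * φ g := by
    intro g h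
    have e := T' (Pi.single g⁻¹ 1 + s • Pi.single h 1)
      (Pi.single g 1 - s • Pi.single (g * h * g) 1)
      (Pi.single (φ g)⁻¹ 1 + s • Pi.single (φ h) 1)
      (Pi.single (φ g) 1 - s • Pi.single (φ g * φ h * φ g) 1)
      ?_ ?_ ?_ (g * h * g)
    · by_contra hne
      simp only [Pi.sub_apply, Pi.smul_apply, smul_eq_mul, Pi.single_apply, hφ.1.eq_iff, hne,
        if_true, if_false, sub_right_inj] at e
      have h4 : s = 0 := by simpa using e
      exact one_ne_zero (hst 1 (by simp [h4]))
    · intro k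
      simp [Pi.single_apply, hφ.1.eq_iff, ← hinv]
    · have := FS.ring2 s hs (FS.M (S := S) (Pi.single g⁻¹ 1)) (FS.M (S := S) (Pi.single h 1)) (FS.M (S := S) (Pi.single g 1))
        (by rw [FS.P_mul, inv_mul_cancel, FS.M_one])
      rw [FS.P_mul, FS.P_mul] at this
      simpa only [FS.M_sub, FS.M_add, FS.M_smul, FS.M_one] using this
    · have := FS.ring2 s hs (FS.M (S := S) (Pi.single (φ g)⁻¹ 1)) (FS.M (S := S) (Pi.single (φ h) 1))
        (FS.M (S := S) (Pi.single (φ g) 1)) (by rw [FS.P_mul, inv_mul_cancel, FS.M_one])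
      rw [FS.P_mul, FS.P_mul] at this
      simpa only [FS.M_sub, FS.M_add, FS.M_smul, FS.M_one] using this
  have hc : ∀ g h, g * h = h * g → φ g * φ h = φ h * φ g := by
    intro g h e
    by_contra hne
    obtain ⟨k, hk⟩ := hφ.2 (φ g * φ h)
    have j := hJ g h k
    rw [← e, hk] at j
    simp only [hne, if_true, if_false, add_zero] at j
    by_cases hkk : k = g * h
    · simp [hkk] at j
    · simp [hkk] at j
  have hh : ∀ g h, φ (g * h) = φ g * φ h ∨ φ (g * h) = φ h * φ g := by
    intro g h
    by_contra! hne
    have j := hJ g h (g * h)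
    simp only [hne.1, hne.2, if_true, if_false, add_zero] at j
    by_cases e : g * h = h * g
    · rw [if_pos e] at j
      have h2 : ((2 : ℕ) : K) = 0 := by
        rw [← j]; push_cast; norm_num
      have hdvd := (ringChar.spec K 2).1 h2
      have hrc : ringChar K = 2 := by
        rcases (Nat.dvd_prime Nat.prime_two).1 hdvd with h | h
        · exact absurd (h ▸ one_dvd _) hchar
        · exact h
      rw [hrc] at hchar
      obtain ⟨m, hm⟩ : ∃ m, Fintype.card G = 2 * m + 1 := ⟨Fintype.card G / 2, by omega⟩
      have hk : h ^ (m + 1) * h ^ (m + 1) = h := by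
        rw [← pow_add, show m + 1 + (m + 1) = Fintype.card G + 1 by omega, pow_succ,
          pow_card_eq_one, one_mul]
      have hcm : g * h ^ (m + 1) = h ^ (m + 1) * g := (show Commute g h from e).pow_right (m + 1)
      generalize h ^ (m + 1) = k at *
      have e1 : φ h = φ k * φ k := by
        have := hQ k 1
        rwa [mul_one, hk, h1, mul_one] at this
      have e2 := hQ k g
      rw [← hcm, mul_assoc, hk, ← hc g k hcm, mul_assoc, ← e1] at e2
      exact hne.1 e2
    · rw [if_neg e] at j
      simp at j
  have main := FS.half φ hφ.1 hinv hc hh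
  refine ⟨main, ?_⟩
  rcases main with h | h
  · exact ⟨MulEquiv.mk (Equiv.ofBijective φ hφ) h⟩
  · refine ⟨MulEquiv.mk ((Equiv.inv G).trans (Equiv.ofBijective φ hφ)) ?_⟩
    intro a b
    simp [h]
end
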